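/- The complete graph K_21 admits a triangular biembedding: there exist two spanning subgraphs G₁ and G₂ of the complete graph on 21 vertices whose edge sets partition the edge set of K_21, each admitting a triangular rotation system. -/

import Mathlib

/-- A rotation system on a simple graph `G`: each vertex `v` is assigned a permutation of the
vertex set that fixes all non-neighbors of `v`, maps neighbors of `v` to neighbors of `v`,
and acts as a single cycle on the neighborhood of `v` (expressed here as transitivity of the
cyclic group generated by the permutation on the neighborhood). -/
structure RotationSystem {V : Type*} (G : SimpleGraph V) where
  ρ : V → Equiv.Perm V
  mem_neighbor : ∀ v u : V, G.Adj v u → G.Adj v (ρ v u)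
  fixes : ∀ v u : V, ¬ G.Adj v u → ρ v u = u
  single_cycle : ∀ v u w : V, G.Adj v u → G.Adj v w → ∃ k : ℕ, ((ρ v) ^ k) u = w

namespace RotationSystem

/-- The face permutation of a rotation system: the dart `(u, v)` is sent to `(v, ρ_v(u))`. -/
def facePerm {V : Type*} {G : SimpleGraph V} (R : RotationSystem G) : G.Dart → G.Dart :=
  fun d => ⟨(d.snd, R.ρ d.snd d.fst), R.mem_neighbor d.snd d.fst d.adj.symm⟩

/-- A rotation system is triangular if every face has length 3, i.e. every dart has minimal
period 3 under the face permutation. -/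
def Triangular {V : Type*} {G : SimpleGraph V} (R : RotationSystem G) : Prop :=
  ∀ d : G.Dart, Function.minimalPeriod R.facePerm d = 3

/-- The number of faces of a rotation system: the number of orbits of the face permutation on
the set of darts (an orbit is recorded as the set of forward iterates of a dart). -/
noncomputable def numFaces {V : Type*} {G : SimpleGraph V} (R : RotationSystem G) : ℕ :=
  Nat.card (Set.range fun d : G.Dart => Set.range fun k : ℕ => R.facePerm^[k] d)

end RotationSystem

/-- The circulant graph `C(n, X)` on vertex set `ℤ/nℤ`: `i` and `j` are adjacent iff `i ≠ j`
and `i - j ≡ ±x (mod n)` for some `x ∈ X`. -/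
def circulant (n : ℕ) (X : Set ℕ) : SimpleGraph (ZMod n) :=
  SimpleGraph.fromRel (fun i j => ∃ x ∈ X, i - j = (x : ZMod n))

/-- The simple graph in which `u` and `v` are adjacent iff `u` belongs to the list `l v`. -/
def graphOfLists {V : Type*} (l : V → List V) (hs : ∀ u v, u ∈ l v → v ∈ l u)
    (hi : ∀ v, v ∉ l v) : SimpleGraph V where
  Adj v u := u ∈ l v
  symm := ⟨fun v u h => hs u v h⟩
  loopless := ⟨hi⟩

/-- Cyclically ordered duplicate-free lists of neighbors form a rotation system. -/
def rotationOfLists {V : Type*} [DecidableEq V] (l : V → List V)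
    (hs : ∀ u v, u ∈ l v → v ∈ l u) (hi : ∀ v, v ∉ l v) (hn : ∀ v, (l v).Nodup) :
    RotationSystem (graphOfLists l hs hi) where
  ρ v := (l v).formPerm
  mem_neighbor _ _ h := List.formPerm_apply_mem_of_mem h
  fixes _ _ h := List.formPerm_apply_of_notMem h
  single_cycle v u w hu hw := by
    obtain ⟨i, hi, rfl⟩ := List.getElem_of_mem hu
    obtain ⟨j, hj, rfl⟩ := List.getElem_of_mem hw
    refine ⟨(l v).length - i + j, ?_⟩
    rw [List.formPerm_pow_apply_getElem _ (hn v)]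
    congr 1
    rw [← add_assoc, Nat.add_sub_cancel' hi.le, Nat.add_mod_left, Nat.mod_eq_of_lt hj]

theorem rotationOfLists_triangular {V : Type*} [DecidableEq V] (l : V → List V)
    (hs : ∀ u v, u ∈ l v → v ∈ l u) (hi : ∀ v, v ∉ l v) (hn : ∀ v, (l v).Nodup)
    (ht : ∀ v, ∀ u ∈ l v, (l ((l v).formPerm u)).formPerm v = u) :
    (rotationOfLists l hs hi hn).Triangular := by
  intro d
  have : Fact (Nat.Prime 3) := ⟨Nat.prime_three⟩
  refine Function.minimalPeriod_eq_prime ?_ ?_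
  · obtain ⟨⟨u, v⟩, h⟩ := d
    have hu : u ∈ l v := hs v u h
    have hw : (l v).formPerm u ∈ l v := List.formPerm_apply_mem_of_mem hu
    have h₁ := ht v u hu
    have h₂ := ht _ v (hs _ _ hw)
    rw [h₁] at h₂
    refine SimpleGraph.Dart.ext _ _ (Prod.ext ?_ ?_)
    · exact h₁
    · change (l ((l ((l v).formPerm u)).formPerm v)).formPerm ((l v).formPerm u) = v
      rw [h₁, h₂]
  · intro h
    exact d.adj.ne (congrArg (fun e : SimpleGraph.Dart _ => e.fst) h).symm

/-- The action of `ℤ/7ℤ` on `Fin 21` rotating each of the blocks `{0, …, 6}`, `{7, …, 13}` and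
`{14, …, 20}`. -/
def blockShift (t u : Fin 21) : Fin 21 :=
  Fin.ofNat 21 (7 * (u.val / 7) + (u.val + t.val) % 7)

/-- The neighbor lists invariant under `blockShift` whose values at the first vertices of the
three blocks are `a`, `b` and `c`. -/
def shiftedLists (a b c : List (Fin 21)) (v : Fin 21) : List (Fin 21) :=
  (if v.val < 7 then a else if v.val < 14 then b else c).map (blockShift ⟨v.val % 7, by omega⟩)

/-- The rotations of the first triangular embedding. -/
def firstRotation : Fin 21 → List (Fin 21) :=
  shiftedLists [1, 14, 4, 13, 2, 19, 9, 3, 17, 5, 11, 20, 6, 7, 8]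
    [0, 6, 13, 16, 3, 1, 5, 17, 8] [0, 1, 12, 11, 2, 4]

/-- The rotations of the second triangular embedding. -/
def secondRotation : Fin 21 → List (Fin 21) :=
  shiftedLists [10, 15, 18, 16, 12]
    [2, 18, 11, 19, 4, 9, 15, 10, 14, 20, 12] [3, 18, 20, 7, 10, 5, 16, 17, 6, 9, 13, 8, 15, 19]

/-- The complete graph on 21 vertices admits a triangular biembedding. -/
theorem complete_graph_21_triangular_biembedding :
    ∃ G₁ G₂ : SimpleGraph (Fin 21),
      G₁ ⊔ G₂ = ⊤ ∧ G₁ ⊓ G₂ = ⊥ ∧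
      (∃ R₁ : RotationSystem G₁, R₁.Triangular) ∧
      (∃ R₂ : RotationSystem G₂, R₂.Triangular) := by
  have hs₁ : ∀ u v, u ∈ firstRotation v → v ∈ firstRotation u := by decide +kernel
  have hi₁ : ∀ v, v ∉ firstRotation v := by decide +kernel
  have hs₂ : ∀ u v, u ∈ secondRotation v → v ∈ secondRotation u := by decide +kernel
  have hi₂ : ∀ v, v ∉ secondRotation v := by decide +kernel
  have hsup : ∀ v u, u ∈ firstRotation v ∨ u ∈ secondRotation v ↔ v ≠ u := by decide +kernel
  have hinf : ∀ v u, ¬ (u ∈ firstRotation v ∧ u ∈ secondRotation v) := by decide +kernel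
  refine ⟨graphOfLists firstRotation hs₁ hi₁, graphOfLists secondRotation hs₂ hi₂, ?_, ?_,
    ⟨rotationOfLists _ hs₁ hi₁ (by decide +kernel),
      rotationOfLists_triangular firstRotation _ _ _ (by decide +kernel)⟩,
    ⟨rotationOfLists _ hs₂ hi₂ (by decide +kernel),
      rotationOfLists_triangular secondRotation _ _ _ (by decide +kernel)⟩⟩
  · ext v u
    exact hsup v u
  · ext v u
    exact iff_of_false (hinf v u) id
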